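/- Let 0 < α < 1. There exists a constant c > 0, depending only on α, with the following property. Let V be a nontrivial finite-dimensional complex inner product space, A : V → V a self-adjoint positive definite linear operator, τ > 0, and v ∈ V. Define U^0 = v and, for n ≥ 1, let U^n ∈ V be the (unique) solution of the homogeneous backward Euler CQ scheme τ^{-α} Σ_{j=0}^n b_j^{(α)} (U^{n-j} - v) + A U^n = 0. Then for every β ∈ [0,1] and every n ≥ 1, ‖A^β U^n‖ ≤ c · t_{n+1}^{-βα} · ‖v‖, where t_k = kτ and A^β is the fractional power of A defined by the spectral calculus. -/

import Mathlib

open scoped ComplexInnerProductSpace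

/-- The backward Euler convolution quadrature weights `b_j^(α) = (-1)^j binom(α, j)`. -/
noncomputable def cqWeight (α : ℝ) (j : ℕ) : ℝ :=
  (-1 : ℝ) ^ j * (∏ i ∈ Finset.range j, (α - i)) / (Nat.factorial j)

/-- Fractional power `A^β` of a (selfadjoint positive) operator on a finite-dimensional
complex inner product space, via the (continuous) functional calculus, which in this
setting coincides with the spectral calculus. -/
noncomputable def opRPow {V : Type} [NormedAddCommGroup V] [InnerProductSpace ℂ V]
    [FiniteDimensional ℂ V] (A : V →L[ℂ] V) (β : ℝ) : V →L[ℂ] V :=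
  cfc (fun x : ℝ => x ^ β) A

/-- The partial sums of the convolution quadrature weights, in product form. -/
noncomputable def cqPartialSum (α : ℝ) (n : ℕ) : ℝ :=
  ∏ i ∈ Finset.range n, (1 - α / ((i : ℝ) + 1))

lemma cqPartialSum_zero (α : ℝ) : cqPartialSum α 0 = 1 := by simp [cqPartialSum]

lemma cqPartialSum_succ (α : ℝ) (n : ℕ) :
    cqPartialSum α (n + 1) = cqPartialSum α n * (1 - α / ((n : ℝ) + 1)) := by
  simp [cqPartialSum, Finset.prod_range_succ]

lemma cqPartialSum_nonneg {α : ℝ} (hα1 : α < 1) (n : ℕ) : 0 ≤ cqPartialSum α n := by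
  refine Finset.prod_nonneg fun i _ => ?_
  have hi : (0 : ℝ) ≤ i := i.cast_nonneg
  rw [sub_nonneg, div_le_one (by positivity)]
  linarith

lemma cqWeight_zero (α : ℝ) : cqWeight α 0 = 1 := by simp [cqWeight]

lemma cqWeight_succ (α : ℝ) (n : ℕ) :
    cqWeight α (n + 1) = -(α / ((n : ℝ) + 1)) * cqPartialSum α n := by
  have step : ∀ m : ℕ, cqWeight α (m + 1) = cqWeight α m * ((m - α) / (m + 1)) := by
    intro m
    have hm : (m : ℝ) + 1 ≠ 0 := by positivity
    have hf : ((Nat.factorial m : ℕ) : ℝ) ≠ 0 := by positivity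
    simp only [cqWeight, Finset.prod_range_succ, Nat.factorial_succ, pow_succ]
    push_cast
    field_simp
    ring
  induction n with
  | zero => simp [step, cqWeight_zero, cqPartialSum_zero]
  | succ n ih =>
    rw [step, ih, cqPartialSum_succ]
    have h1 : (n : ℝ) + 1 ≠ 0 := by positivity
    have h2 : (n : ℝ) + 1 + 1 ≠ 0 := by positivity
    push_cast
    field_simp

lemma cqWeight_succ_eq_sub (α : ℝ) (n : ℕ) :
    cqWeight α (n + 1) = cqPartialSum α (n + 1) - cqPartialSum α n := by
  rw [cqWeight_succ, cqPartialSum_succ]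
  ring

lemma cqWeight_succ_nonpos {α : ℝ} (hα0 : 0 < α) (hα1 : α < 1) (n : ℕ) :
    cqWeight α (n + 1) ≤ 0 := by
  rw [cqWeight_succ, neg_mul]
  have := cqPartialSum_nonneg hα1 n
  exact neg_nonpos.2 (by positivity)

lemma sum_cqWeight (α : ℝ) (n : ℕ) :
    ∑ j ∈ Finset.range (n + 1), cqWeight α j = cqPartialSum α n := by
  induction n with
  | zero => simp [cqWeight_zero, cqPartialSum_zero]
  | succ n ih => rw [Finset.sum_range_succ, ih, cqWeight_succ_eq_sub]; ring

lemma sum_cqWeight_succ (α : ℝ) (n : ℕ) :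
    ∑ j ∈ Finset.range n, cqWeight α (j + 1) = cqPartialSum α n - 1 := by
  rw [← sum_cqWeight, Finset.sum_range_succ', cqWeight_zero]
  ring

lemma sum_cqPartialSum {α : ℝ} (hα1 : α < 1) (n : ℕ) :
    ∑ k ∈ Finset.range n, cqPartialSum α k = n * cqPartialSum α n / (1 - α) := by
  have h : 1 - α ≠ 0 := by linarith
  induction n with
  | zero => simp
  | succ n ih =>
    have h1 : (n : ℝ) + 1 ≠ 0 := by positivity
    rw [Finset.sum_range_succ, ih, cqPartialSum_succ]
    push_cast
    field_simp
    ring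

lemma cqPartialSum_le_rpow {α : ℝ} (hα0 : 0 < α) (hα1 : α < 1) (n : ℕ) :
    cqPartialSum α n ≤ ((n : ℝ) + 1) ^ (-α) := by
  induction n with
  | zero => simp [cqPartialSum_zero]
  | succ n ih =>
    have hn : (0 : ℝ) < (n : ℝ) + 1 := by positivity
    have hq : α / ((n : ℝ) + 1) ≤ 1 := by
      rw [div_le_one hn]; linarith [n.cast_nonneg (α := ℝ)]
    have hq0 : 0 < α / ((n : ℝ) + 1) := by positivity
    have bern : (1 + 1 / ((n : ℝ) + 1)) ^ α ≤ 1 + α * (1 / ((n : ℝ) + 1)) :=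
      rpow_one_add_le_one_add_mul_self
        (le_trans (by norm_num) (by positivity : (0 : ℝ) ≤ 1 / ((n : ℝ) + 1))) hα0.le hα1.le
    have hpos : 0 < (1 + 1 / ((n : ℝ) + 1)) ^ α := by positivity
    have key : 1 - α / ((n : ℝ) + 1) ≤ (1 + 1 / ((n : ℝ) + 1)) ^ (-α) := by
      rw [Real.rpow_neg (by positivity), ← one_div, le_div_iff₀ hpos]
      rw [mul_one_div] at bern
      calc _ ≤ (1 - α / ((n : ℝ) + 1)) * (1 + α / ((n : ℝ) + 1)) := by
            gcongr
        _ ≤ 1 := by nlinarith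
    have hsplit : ((n + 1 : ℕ) : ℝ) + 1 = ((n : ℝ) + 1) * (1 + 1 / ((n : ℝ) + 1)) := by
      push_cast
      field_simp
    rw [cqPartialSum_succ, hsplit, Real.mul_rpow hn.le (by positivity)]
    exact mul_le_mul ih key (by linarith) (by positivity)

/-- The solution of the scalar scheme with initial value `1`, where `z` stands for
`τ ^ α` times an eigenvalue. -/
noncomputable def cqSolution (α z : ℝ) : ℕ → ℝ
  | 0 => 1
  | n + 1 => (1 + z)⁻¹ * (cqPartialSum α n -
      ∑ j : Fin n, cqWeight α (j + 1) * cqSolution α z (n - j))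

lemma cqSolution_zero (α z : ℝ) : cqSolution α z 0 = 1 := by rw [cqSolution]

lemma cqSolution_succ {z : ℝ} (α : ℝ) (hz : 0 < z) (n : ℕ) :
    (1 + z) * cqSolution α z (n + 1) = cqPartialSum α n -
      ∑ j ∈ Finset.range n, cqWeight α (j + 1) * cqSolution α z (n - j) := by
  rw [cqSolution, mul_inv_cancel_left₀ (by positivity),
    Fin.sum_univ_eq_sum_range fun j => cqWeight α (j + 1) * cqSolution α z (n - j)]

section Scalar

variable {α z : ℝ}

lemma cqSolution_nonneg (hα0 : 0 < α) (hα1 : α < 1) (hz : 0 < z) (n : ℕ) :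
    0 ≤ cqSolution α z n := by
  induction n using Nat.strong_induction_on with
  | _ n ih =>
    cases n with
    | zero => simp [cqSolution_zero]
    | succ n =>
      have h := cqSolution_succ α hz n
      have hs : ∑ j ∈ Finset.range n, cqWeight α (j + 1) * cqSolution α z (n - j) ≤ 0 :=
        Finset.sum_nonpos fun j _ =>
          mul_nonpos_of_nonpos_of_nonneg (cqWeight_succ_nonpos hα0 hα1 j) (ih _ (by omega))
      have := cqPartialSum_nonneg hα1 n
      exact nonneg_of_mul_nonneg_right (a := 1 + z) (by linarith) (by positivity)

lemma cqSolution_le_one (hα0 : 0 < α) (hα1 : α < 1) (hz : 0 < z) (n : ℕ) :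
    cqSolution α z n ≤ 1 := by
  induction n using Nat.strong_induction_on with
  | _ n ih =>
    cases n with
    | zero => simp [cqSolution_zero]
    | succ n =>
      have h := cqSolution_succ α hz n
      have hs : ∑ j ∈ Finset.range n, cqWeight α (j + 1) ≤
          ∑ j ∈ Finset.range n, cqWeight α (j + 1) * cqSolution α z (n - j) :=
        Finset.sum_le_sum fun j _ => by
          nlinarith [cqWeight_succ_nonpos hα0 hα1 j, ih (n - j) (by omega)]
      rw [sum_cqWeight_succ] at hs
      nlinarith [cqSolution_nonneg hα0 hα1 hz (n + 1)]

lemma cqSolution_antitone (hα0 : 0 < α) (hα1 : α < 1) (hz : 0 < z) :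
    Antitone (cqSolution α z) := by
  refine antitone_nat_of_succ_le fun n => ?_
  induction n using Nat.strong_induction_on with
  | _ n ih =>
    cases n with
    | zero => rw [cqSolution_zero]; exact cqSolution_le_one hα0 hα1 hz _
    | succ m =>
      have h1 := cqSolution_succ α hz m
      have h2 := cqSolution_succ α hz (m + 1)
      rw [Finset.sum_range_succ, show m + 1 - m = 1 by omega] at h2
      have hs : ∑ j ∈ Finset.range m, cqWeight α (j + 1) * cqSolution α z (m - j) ≤
          ∑ j ∈ Finset.range m, cqWeight α (j + 1) * cqSolution α z (m + 1 - j) :=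
        Finset.sum_le_sum fun j hj => by
          have hj := Finset.mem_range.1 hj
          rw [show m + 1 - j = m - j + 1 by omega]
          exact mul_le_mul_of_nonpos_left (ih (m - j) (by omega))
            (cqWeight_succ_nonpos hα0 hα1 j)
      have h3 := cqWeight_succ_eq_sub α m
      have h4 : cqWeight α (m + 1) ≤ cqWeight α (m + 1) * cqSolution α z 1 := by
        nlinarith [cqWeight_succ_nonpos hα0 hα1 m, cqSolution_le_one hα0 hα1 hz 1]
      exact le_of_mul_le_mul_left (a := 1 + z) (by linarith) (by positivity)

lemma sum_mul_cqSolution (α : ℝ) (hz : 0 < z) (n : ℕ) :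
    ∑ m ∈ Finset.range n, z * cqSolution α z (m + 1) =
      ∑ k ∈ Finset.range n, cqPartialSum α k * (1 - cqSolution α z (n - k)) := by
  induction n with
  | zero => simp
  | succ n ih =>
    have h1 : ∑ k ∈ Finset.range n,
        cqPartialSum α (k + 1) * (1 - cqSolution α z (n + 1 - (k + 1))) =
        ∑ k ∈ Finset.range n, cqPartialSum α k * (1 - cqSolution α z (n - k)) +
        (∑ k ∈ Finset.range n, cqWeight α (k + 1) -
          ∑ k ∈ Finset.range n, cqWeight α (k + 1) * cqSolution α z (n - k)) := by
      rw [← Finset.sum_sub_distrib, ← Finset.sum_add_distrib]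
      refine Finset.sum_congr rfl fun k _ => ?_
      rw [cqWeight_succ_eq_sub, show n + 1 - (k + 1) = n - k by omega]
      ring
    have h2 := cqSolution_succ α hz n
    rw [Finset.sum_range_succ, ih, Finset.sum_range_succ', h1, sum_cqWeight_succ,
      cqPartialSum_zero, Nat.sub_zero]
    linarith

lemma mul_cqSolution_le (hα0 : 0 < α) (hα1 : α < 1) (hz : 0 < z) {n : ℕ} (hn : 1 ≤ n) :
    z * cqSolution α z n ≤ (1 - α)⁻¹ * ((n : ℝ) + 1) ^ (-α) := by
  have hn0 : (0 : ℝ) < n := by exact_mod_cast hn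
  have hlow : (n : ℝ) * (z * cqSolution α z n) ≤
      ∑ m ∈ Finset.range n, z * cqSolution α z (m + 1) := by
    rw [← nsmul_eq_mul]
    nth_rewrite 1 [← Finset.card_range n]
    refine Finset.card_nsmul_le_sum _ _ _ fun m hm => ?_
    have hm := Finset.mem_range.1 hm
    exact mul_le_mul_of_nonneg_left (cqSolution_antitone hα0 hα1 hz (by omega)) hz.le
  have hup : ∑ k ∈ Finset.range n, cqPartialSum α k * (1 - cqSolution α z (n - k)) ≤
      ∑ k ∈ Finset.range n, cqPartialSum α k :=
    Finset.sum_le_sum fun k _ => mul_le_of_le_one_right (cqPartialSum_nonneg hα1 k)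
      (by linarith [cqSolution_nonneg hα0 hα1 hz (n - k)])
  rw [sum_cqPartialSum hα1] at hup
  have h : (n : ℝ) * (z * cqSolution α z n) ≤ n * ((1 - α)⁻¹ * cqPartialSum α n) := by
    rw [sum_mul_cqSolution α hz] at hlow
    calc _ ≤ _ := hlow.trans hup
      _ = _ := by ring
  refine (le_of_mul_le_mul_left h hn0).trans ?_
  have : 0 ≤ (1 - α)⁻¹ := inv_nonneg.2 (by linarith)
  gcongr
  exact cqPartialSum_le_rpow hα0 hα1 n

lemma rpow_mul_cqSolution_le (hα0 : 0 < α) (hα1 : α < 1) {τ l β : ℝ} (hτ : 0 < τ) (hl : 0 < l)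
    (hβ0 : 0 ≤ β) (hβ1 : β ≤ 1) {n : ℕ} (hn : 1 ≤ n) :
    l ^ β * cqSolution α (τ ^ α * l) n ≤
      (1 - α)⁻¹ * (((n : ℝ) + 1) * τ) ^ (-(β * α)) := by
  have hz : 0 < τ ^ α * l := by positivity
  have hu0 := cqSolution_nonneg hα0 hα1 hz n
  have hu1 := cqSolution_le_one hα0 hα1 hz n
  have hzu := mul_cqSolution_le hα0 hα1 hz hn
  set u := cqSolution α (τ ^ α * l) n
  have hn1 : (0 : ℝ) < (n : ℝ) + 1 := by positivity
  have hC : 1 ≤ (1 - α)⁻¹ := (one_le_inv₀ (by linarith)).2 (by linarith)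
  have huβ : u ≤ u ^ β := Real.self_le_rpow_of_le_one hu0 hu1 hβ1
  have hl_eq : l ^ β * u ^ β = τ ^ (-(β * α)) * (τ ^ α * l * u) ^ β := by
    rw [Real.mul_rpow hz.le hu0, Real.mul_rpow (by positivity) hl.le, ← Real.rpow_mul hτ.le,
      ← mul_assoc, ← mul_assoc, ← Real.rpow_add hτ]
    rw [show -(β * α) + α * β = 0 by ring, Real.rpow_zero, one_mul]
  calc l ^ β * u ≤ l ^ β * u ^ β := by gcongr
    _ = τ ^ (-(β * α)) * (τ ^ α * l * u) ^ β := hl_eq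
    _ ≤ τ ^ (-(β * α)) * ((1 - α)⁻¹ * ((n : ℝ) + 1) ^ (-α)) ^ β := by gcongr
    _ = τ ^ (-(β * α)) * (((1 - α)⁻¹) ^ β * ((n : ℝ) + 1) ^ (-(β * α))) := by
      rw [Real.mul_rpow (by linarith) (by positivity), ← Real.rpow_mul hn1.le,
        show -α * β = -(β * α) by ring]
    _ ≤ τ ^ (-(β * α)) * ((1 - α)⁻¹ * ((n : ℝ) + 1) ^ (-(β * α))) := by
      gcongr
      exact Real.rpow_le_self_of_one_le hC hβ1
    _ = _ := by rw [Real.mul_rpow hn1.le hτ.le]; ring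

/-- The scalar scheme with initial value `x 0` has the solution `cqSolution` times `x 0`. -/
lemma eq_cqSolution_mul (hz : 0 < z) {x : ℕ → ℂ}
    (hx : ∀ n : ℕ, 1 ≤ n →
      ∑ j ∈ Finset.range (n + 1), (cqWeight α j : ℂ) * (x (n - j) - x 0) + z * x n = 0) (n : ℕ) :
    x n = cqSolution α z n * x 0 := by
  induction n using Nat.strong_induction_on with
  | _ n ih =>
    cases n with
    | zero => simp [cqSolution_zero]
    | succ n =>
      have h := hx (n + 1) (by omega)
      rw [Finset.sum_range_succ, Nat.sub_self, sub_self, mul_zero, add_zero,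
        Finset.sum_range_succ', cqWeight_zero, Nat.sub_zero] at h
      have h1 : ∑ j ∈ Finset.range n,
          (cqWeight α (j + 1) : ℂ) * (x (n + 1 - (j + 1)) - x 0) =
          (((∑ j ∈ Finset.range n, cqWeight α (j + 1) * cqSolution α z (n - j)) -
            ∑ j ∈ Finset.range n, cqWeight α (j + 1) : ℝ) : ℂ) * x 0 := by
        rw [← Finset.sum_sub_distrib, Complex.ofReal_sum, Finset.sum_mul]
        refine Finset.sum_congr rfl fun j _ => ?_
        rw [show n + 1 - (j + 1) = n - j by omega, ih (n - j) (by omega)]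
        push_cast
        ring
      rw [h1, sum_cqWeight_succ] at h
      have h2 := congrArg (fun r : ℝ => (r : ℂ)) (cqSolution_succ α hz n)
      have hz0 : (1 + z : ℂ) ≠ 0 := by exact_mod_cast (by positivity : 1 + z ≠ 0)
      refine mul_left_cancel₀ hz0 ?_
      push_cast at h h2
      linear_combination h - x 0 * h2

end Scalar

section Operator

variable {V : Type*} [NormedAddCommGroup V] [InnerProductSpace ℂ V]

lemma aeval_apply_of_eigenvector {A : V →L[ℂ] V} {l : ℝ} {e : V} (he : A e = (l : ℂ) • e)
    (p : Polynomial ℝ) : Polynomial.aeval A p e = ((p.eval l : ℝ) : ℂ) • e := by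
  induction p using Polynomial.induction_on with
  | C a => simp [Algebra.algebraMap_eq_smul_one]
  | add p q hp hq => simp [hp, hq, add_smul]
  | monomial n a ih =>
    simp only [map_mul, map_pow, Polynomial.aeval_X, Polynomial.eval_mul, Polynomial.eval_pow,
      Polynomial.eval_X] at ih ⊢
    rw [pow_succ, ← mul_assoc, ContinuousLinearMap.mul_def, ContinuousLinearMap.comp_apply, he,
      map_smul, ih, smul_smul]
    push_cast
    ring_nf

lemma cfc_apply_of_eigenvector [FiniteDimensional ℂ V] {A : V →L[ℂ] V} (hA : IsSelfAdjoint A)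
    (f : ℝ → ℝ) {l : ℝ} {e : V} (he : A e = (l : ℂ) • e) : cfc f A e = (f l : ℂ) • e := by
  have hfin : (spectrum ℝ A).Finite := by
    rw [← spectrum.preimage_algebraMap ℂ, ContinuousLinearMap.spectrum_eq]
    exact (Module.End.finite_spectrum _).preimage
      (FaithfulSMul.algebraMap_injective ℝ ℂ).injOn
  let s : Finset ℝ := insert l hfin.toFinset
  let p := Lagrange.interpolate s id f
  have hp : ∀ x ∈ s, p.eval x = f x := fun x hx =>
    Lagrange.eval_interpolate_at_node f (Set.injOn_id _) hx
  have hfp : (spectrum ℝ A).EqOn f p.eval := fun x hx =>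
    (hp x (Finset.mem_insert_of_mem (hfin.mem_toFinset.2 hx))).symm
  rw [cfc_congr hfp, cfc_polynomial p A hA, aeval_apply_of_eigenvector he,
    hp l (Finset.mem_insert_self _ _)]

end Operator

/-- Smoothing property of the homogeneous backward Euler CQ scheme:
`‖A^β U^n‖ ≤ c t_{n+1}^{-βα} ‖v‖`. -/
theorem homogeneous_scheme_smoothing (α : ℝ) (hα0 : 0 < α) (hα1 : α < 1) :
    ∃ c : ℝ, 0 < c ∧
      ∀ (V : Type) (_ : NormedAddCommGroup V) (_ : InnerProductSpace ℂ V)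
        (_ : FiniteDimensional ℂ V) (_ : Nontrivial V)
        (A : V →L[ℂ] V), IsSelfAdjoint A →
        (∀ x : V, x ≠ 0 → 0 < (⟪A x, x⟫).re) →
        ∀ τ : ℝ, 0 < τ → ∀ (v : V) (U : ℕ → V), U 0 = v →
        (∀ n : ℕ, 1 ≤ n →
          τ ^ (-α) • (∑ j ∈ Finset.range (n + 1), cqWeight α j • (U (n - j) - v)) + A (U n) = 0) →
        ∀ β : ℝ, 0 ≤ β → β ≤ 1 → ∀ n : ℕ, 1 ≤ n →
          ‖opRPow A β (U n)‖ ≤ c * ((((n : ℝ) + 1) * τ) ^ (-(β * α))) * ‖v‖ := by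
  have hC : 0 < (1 - α)⁻¹ := inv_pos.2 (by linarith)
  refine ⟨(1 - α)⁻¹, hC, ?_⟩
  intro V _ _ _ _ A hA hpos τ hτ v U hU0 hU β hβ0 hβ1 n hn
  have hsymm : (A : V →ₗ[ℂ] V).IsSymmetric := hA.isSymmetric
  let b := hsymm.eigenvectorBasis rfl
  let l := hsymm.eigenvalues rfl
  have hb : ∀ i, A (b i) = (l i : ℂ) • b i := fun i => hsymm.apply_eigenvectorBasis rfl i
  have hb0 : ∀ i, b i ≠ 0 := fun i => b.orthonormal.ne_zero i
  have hl : ∀ i, 0 < l i := by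
    intro i
    have h := hpos (b i) (hb0 i)
    rw [hb, inner_smul_left, inner_self_eq_norm_sq_to_K, b.orthonormal.norm_eq_one] at h
    simpa using h
  have hcomp : ∀ i m, ⟪b i, U m⟫ = cqSolution α (τ ^ α * l i) m * ⟪b i, v⟫ := by
    intro i m
    have hz : 0 < τ ^ α * l i := mul_pos (by positivity) (hl i)
    rw [← hU0]
    refine eq_cqSolution_mul (x := fun m => ⟪b i, U m⟫) hz (fun k hk => ?_) m
    have h := congrArg (fun y => ⟪b i, y⟫) (hU k hk)
    have hAi : ⟪b i, A (U k)⟫ = l i * ⟪b i, U k⟫ := by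
      have h := hsymm (b i) (U k)
      simp only [ContinuousLinearMap.coe_coe] at h
      rw [← h, hb, inner_smul_left, Complex.conj_ofReal]
    simp only [← Complex.coe_smul, inner_add_right, inner_smul_right, inner_sum, inner_sub_right,
      inner_zero_right, hAi] at h
    have hτα : ((τ ^ α : ℝ) : ℂ) * ((τ ^ (-α) : ℝ) : ℂ) = 1 := by
      rw [← Complex.ofReal_mul, ← Real.rpow_add hτ, add_neg_cancel, Real.rpow_zero,
        Complex.ofReal_one]
    rw [hU0, Complex.ofReal_mul]
    linear_combination ((τ ^ α : ℝ) : ℂ) * h - hτα * ∑ j ∈ Finset.range (k + 1),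
      (cqWeight α j : ℂ) * (⟪b i, U (k - j)⟫ - ⟪b i, v⟫)
  have hB : ∀ i, ⟪b i, opRPow A β (U n)⟫ =
      ((l i ^ β * cqSolution α (τ ^ α * l i) n : ℝ) : ℂ) * ⟪b i, v⟫ := by
    intro i
    have hself : IsSelfAdjoint (opRPow A β) := cfc_predicate _ A
    have h := hself.isSymmetric (b i) (U n)
    simp only [ContinuousLinearMap.coe_coe] at h
    rw [← h, opRPow, cfc_apply_of_eigenvector hA _ (hb i), inner_smul_left, hcomp]
    simp [mul_assoc]
  refine le_of_sq_le_sq ?_ (by positivity)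
  rw [mul_pow, ← b.sum_sq_norm_inner_right, ← b.sum_sq_norm_inner_right v, Finset.mul_sum]
  refine Finset.sum_le_sum fun i _ => ?_
  have hu := cqSolution_nonneg hα0 hα1 (mul_pos (by positivity : 0 < τ ^ α) (hl i)) n
  rw [hB, norm_mul, mul_pow, Complex.norm_real,
    Real.norm_of_nonneg (mul_nonneg (Real.rpow_nonneg (hl i).le _) hu)]
  refine mul_le_mul_of_nonneg_right (pow_le_pow_left₀ ?_ ?_ 2) (sq_nonneg _)
  · exact mul_nonneg (Real.rpow_nonneg (hl i).le _) hu
  · exact rpow_mul_cqSolution_le hα0 hα1 hτ (hl i) hβ0 hβ1 hn
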